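/- arXiv:2310.11820 — 2 statements merged into one kernel-verified Lean document; each statement's English description precedes it below -/
import Mathlib

section
/- Let g be a quasireductive finite-dimensional Lie superalgebra over F and suppose that the linear map Z(g₀) → End_{g₀}(g₁), z ↦ (v ↦ z • v), is a bijection onto the space of all g₀-module endomorphisms of g₁. Then every even derivation of g is inner: for every even derivation (D₀, D₁) there exists x ∈ g₀ with D₀ = ad x and D₁ = (v ↦ x • v). -/
open LieAlgebra Polynomial

theorem LieAlgebra.hasTrivialRadical_quotient_center {K L : Type*} [Field K] [LieRing L]
    [LieAlgebra K L] [FiniteDimensional K L] (h : radical K L = center K L) :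
    HasTrivialRadical K (L ⧸ center K L) := by
  rw [hasTrivialRadical_iff_no_abelian_ideals]
  intro I hI
  let π : L →ₗ⁅K⁆ L ⧸ center K L :=
    { LieSubmodule.Quotient.mk' (center K L) with map_lie' := fun {_ _} ↦ rfl }
  have hπ : Function.Surjective π := LieSubmodule.Quotient.surjective_mk' _
  have hker (x : L) : π x = 0 ↔ x ∈ center K L :=
    LieSubmodule.Quotient.mk_eq_zero _
  set J : LieIdeal K L := I.comap π
  have hJ : ⁅J, J⁆ ≤ center K L := by
    rw [LieSubmodule.lieIdeal_oper_eq_span, LieSubmodule.lieSpan_le]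
    rintro _ ⟨⟨x, hx⟩, ⟨y, hy⟩, rfl⟩
    have := hI.trivial ⟨π x, by simpa [J] using hx⟩ ⟨π y, by simpa [J] using hy⟩
    exact (hker _).mp (by simpa [Subtype.ext_iff] using this)
  have hJ2 : derivedSeriesOfIdeal K L 2 J = ⊥ := by
    simp only [derivedSeriesOfIdeal_succ, derivedSeriesOfIdeal_zero, eq_bot_iff]
    refine (LieSubmodule.mono_lie hJ hJ).trans ?_
    rw [LieSubmodule.lieIdeal_oper_eq_span, LieSubmodule.lieSpan_le]
    rintro _ ⟨⟨x, hx⟩, ⟨y, hy⟩, rfl⟩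
    exact hy x
  have hJs : IsSolvable J := IsSolvable.mk (R := K) (k := 2) ((J.derivedSeries_eq_bot_iff 2).mpr hJ2)
  have hJc : J ≤ center K L := h ▸ (LieIdeal.solvable_iff_le_radical K L J).mp hJs
  rw [eq_bot_iff]
  intro q hq
  obtain ⟨x, rfl⟩ := hπ q
  exact (hker x).mpr (hJc (by simpa [J] using hq))

theorem LieAlgebra.lie_top_top_eq_top_of_hasTrivialRadical {K L : Type*} [Field K] [CharZero K]
    [LieRing L] [LieAlgebra K L] [FiniteDimensional K L] [HasTrivialRadical K L] :
    ⁅(⊤ : LieIdeal K L), (⊤ : LieIdeal K L)⁆ = ⊤ := by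
  obtain ⟨I, hI⟩ := exists_isCompl ⁅(⊤ : LieIdeal K L), (⊤ : LieIdeal K L)⁆
  have habs : IsLieAbelian I := by
    rw [LieSubmodule.lie_abelian_iff_lie_self_eq_bot, eq_bot_iff, ← hI.inf_eq_bot]
    exact le_inf (LieSubmodule.mono_lie le_top le_top) (LieSubmodule.lie_le_right I I)
  have : I = ⊥ := (hasTrivialRadical_iff_no_abelian_ideals K L).mp inferInstance I habs
  simpa [this] using hI.sup_eq_top

theorem LieAlgebra.exists_derivation_sub_lie_mem_center {K L : Type*} [Field K] [CharZero K]
    [LieRing L] [LieAlgebra K L] [FiniteDimensional K L] (h : radical K L = center K L)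
    (D : LieDerivation K L L) : ∃ y : L, ∀ a, D a - ⁅y, a⁆ ∈ center K L := by
  have := hasTrivialRadical_quotient_center h
  have hD : ∀ z ∈ center K L, D z ∈ center K L := by
    intro z hz a
    have h1 := D.apply_lie_eq_add a z
    rw [hz a, map_zero, hz (D a), add_zero] at h1
    exact h1.symm
  let D' : LieDerivation K (L ⧸ center K L) (L ⧸ center K L) :=
    { toLinearMap := (center K L).toSubmodule.mapQ (center K L).toSubmodule D.toLinearMap hD
      leibniz' := by
        intro a b
        obtain ⟨a, rfl⟩ := LieSubmodule.Quotient.surjective_mk' _ a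
        obtain ⟨b, rfl⟩ := LieSubmodule.Quotient.surjective_mk' _ b
        exact congrArg (LieSubmodule.Quotient.mk' (center K L)) (D.apply_lie_eq_sub a b) }
  obtain ⟨y, hy⟩ := LieDerivation.IsKilling.exists_eq_ad D'
  obtain ⟨y, rfl⟩ := LieSubmodule.Quotient.surjective_mk' _ y
  refine ⟨y, fun a ↦ ?_⟩
  have := LinearMap.congr_fun (LieDerivation.coe_ad_apply_eq_ad_apply (R := K)
    (LieSubmodule.Quotient.mk' (center K L) y)) (LieSubmodule.Quotient.mk' _ a)
  rw [hy] at this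
  rw [← LieSubmodule.Quotient.mk_eq_zero, map_sub, sub_eq_zero]
  exact this.trans
    (LieSubmodule.Quotient.mk_bracket (I := center K L) y a).symm

theorem LieAlgebra.linearMap_eq_zero_of_vanish_on_center_and_lie {K L M : Type*} [Field K]
    [CharZero K] [LieRing L] [LieAlgebra K L] [FiniteDimensional K L] [AddCommGroup M] [Module K M]
    (h : radical K L = center K L) (f : L →ₗ[K] M)
    (hZ : ∀ z ∈ center K L, f z = 0) (hlie : ∀ a b : L, f ⁅a, b⁆ = 0) : f = 0 := by
  have := hasTrivialRadical_quotient_center h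
  let g : (L ⧸ center K L) →ₗ[K] M := (center K L).toSubmodule.liftQ f hZ
  have hg (x : L ⧸ center K L) : g x = 0 := by
    have hx : x ∈ ⁅(⊤ : LieIdeal K (L ⧸ center K L)), (⊤ : LieIdeal K (L ⧸ center K L))⁆ := by
      rw [lie_top_top_eq_top_of_hasTrivialRadical]; trivial
    rw [← LieSubmodule.mem_toSubmodule, LieSubmodule.lieIdeal_oper_eq_linear_span'] at hx
    induction hx using Submodule.span_induction with
    | mem x hx =>
      obtain ⟨a, -, b, -, rfl⟩ := hx
      obtain ⟨a, rfl⟩ := LieSubmodule.Quotient.surjective_mk' _ a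
      obtain ⟨b, rfl⟩ := LieSubmodule.Quotient.surjective_mk' _ b
      exact hlie a b
    | zero => exact map_zero _
    | add x y _ _ hx hy => rw [map_add, hx, hy, add_zero]
    | smul c x _ hx => rw [map_smul, hx, smul_zero]
  ext x
  exact hg (LieSubmodule.Quotient.mk' _ x)

/-- If `φ` commutes with `φ * T - T * φ`, then commuting with `T` acts on polynomials in `φ`
through the formal derivative. -/
theorem Polynomial.aeval_mul_sub_mul_aeval {K A : Type*} [CommRing K] [Ring A] [Algebra K A]
    {φ T ψ : A} (hψ : T * φ - φ * T = ψ) (hc : Commute φ ψ) (p : K[X]) :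
    T * aeval φ p - aeval φ p * T = aeval φ (derivative p) * ψ := by
  induction p using Polynomial.induction_on' with
  | add p q hp hq => simp only [map_add, add_mul, mul_add, ← hp, ← hq]; abel
  | monomial n c =>
    have key : ∀ n : ℕ, T * φ ^ n - φ ^ n * T = n * φ ^ (n - 1) * ψ := by
      intro n
      induction n with
      | zero => simp
      | succ n ih =>
        have : T * φ ^ (n + 1) - φ ^ (n + 1) * T
            = (T * φ ^ n - φ ^ n * T) * φ + φ ^ n * (T * φ - φ * T) := by
          rw [pow_succ]; noncomm_ring
        rw [this, ih, hψ]
        rcases n with _ | n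
        · simp
        · rw [mul_assoc, ← hc.eq, ← mul_assoc, mul_assoc _ _ φ]
          simp only [Nat.add_sub_cancel, ← pow_succ]
          push_cast
          noncomm_ring
    rw [derivative_monomial, aeval_monomial, aeval_monomial]
    have := congrArg (fun x ↦ algebraMap K A c * x) (key n)
    simp only [mul_sub] at this
    rw [← mul_assoc, ← Algebra.commutes c T, map_mul, map_natCast, mul_assoc, mul_assoc, this]
    simp only [mul_assoc]

theorem Module.End.commute_of_isSemisimple_of_commute_lie {K V : Type*} [Field K] [PerfectField K]
    [AddCommGroup V] [Module K V] [FiniteDimensional K V] {φ T : Module.End K V}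
    (hφ : φ.IsSemisimple) (hc : Commute φ (T * φ - φ * T)) : T * φ = φ * T := by
  have hsep : (minpoly K φ).Separable :=
    PerfectField.separable_iff_squarefree.mpr hφ.minpoly_squarefree
  obtain ⟨a, b, hab⟩ := hsep
  have h1 := Polynomial.aeval_mul_sub_mul_aeval rfl hc (minpoly K φ)
  rw [minpoly.aeval, mul_zero, zero_mul, sub_zero] at h1
  have h2 := congrArg (aeval φ) hab
  rw [map_add, map_mul, minpoly.aeval, mul_zero, zero_add, map_one, map_mul] at h2
  rw [← sub_eq_zero, ← one_mul (T * φ - φ * T), ← h2, mul_assoc, ← h1, mul_zero]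

theorem LieModuleHom.eq_zero_of_sq_eq_zero {K L M : Type*} [Field K]
    [LieRing L] [LieAlgebra K L] [AddCommGroup M] [Module K M] [LieRingModule L M] [LieModule K L M]
    (hss : ∀ N : LieSubmodule K L M, ∃ N', IsCompl N N')
    (hcomm : ∀ (φ ψ : M →ₗ⁅K,L⁆ M) (v : M), φ (ψ v) = ψ (φ v))
    (n : M →ₗ⁅K,L⁆ M) (hn : ∀ v, n (n v) = 0) : n = 0 := by
  obtain ⟨C, hC⟩ := hss n.ker
  have hC' : IsCompl C.toSubmodule n.ker.toSubmodule := by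
    rw [LieSubmodule.isCompl_toSubmodule]; exact hC.symm
  have hdec (v : M) : ∃ c ∈ C, ∃ k ∈ n.ker, c + k = v := by
    have : v ∈ C.toSubmodule ⊔ n.ker.toSubmodule := by rw [hC'.sup_eq_top]; trivial
    exact Submodule.mem_sup.mp this
  have hproj {c k : M} (hc : c ∈ C) (hk : k ∈ n.ker) :
      C.toSubmodule.projection n.ker.toSubmodule hC' (c + k) = c := by
    rw [map_add, Submodule.projection_apply_of_mem_left hC' hc,
      Submodule.projection_apply_of_mem_right hC' hk, add_zero]
  let p : M →ₗ⁅K,L⁆ M :=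
    { C.toSubmodule.projection n.ker.toSubmodule hC' with
      map_lie' := by
        intro x v
        obtain ⟨c, hc, k, hk, rfl⟩ := hdec v
        change C.toSubmodule.projection _ hC' _ = ⁅x, C.toSubmodule.projection _ hC' _⁆
        rw [hproj hc hk, lie_add, hproj (C.lie_mem hc) (n.ker.lie_mem hk)] }
  ext v
  obtain ⟨c, hc, k, hk, rfl⟩ := hdec v
  have hp : p c = c := Submodule.projection_apply_of_mem_left hC' hc
  have hn0 : p (n c) = 0 :=
    Submodule.projection_apply_of_mem_right hC' (LieModuleHom.mem_ker.mpr (hn c))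
  rw [map_add, LieModuleHom.mem_ker.mp hk, add_zero, ← hp, hcomm, hn0, LieModuleHom.zero_apply]

theorem LieModuleHom.isSemisimple_of_commute {K L M : Type*} [Field K] [PerfectField K]
    [LieRing L] [LieAlgebra K L] [AddCommGroup M] [Module K M] [FiniteDimensional K M]
    [LieRingModule L M] [LieModule K L M]
    (hss : ∀ N : LieSubmodule K L M, ∃ N', IsCompl N N')
    (hcomm : ∀ (φ ψ : M →ₗ⁅K,L⁆ M) (v : M), φ (ψ v) = ψ (φ v))
    (φ : M →ₗ⁅K,L⁆ M) : Module.End.IsSemisimple (φ : M →ₗ[K] M) := by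
  let E : Subalgebra K (Module.End K M) :=
    Subalgebra.centralizer K (Set.range (LieModule.toEnd K L M))
  have hE (f : E) (x : L) (v : M) : f.1 ⁅x, v⁆ = ⁅x, f.1 v⁆ :=
    (LinearMap.congr_fun (Subalgebra.mem_centralizer_iff K |>.mp f.2 _ ⟨x, rfl⟩) v).symm
  have : IsReduced E := by
    rw [isReduced_iff_pow_one_lt 2 one_lt_two]
    intro f hf
    let n : M →ₗ⁅K,L⁆ M := { f.1 with map_lie' := hE f _ _ }
    have hn : n = 0 := LieModuleHom.eq_zero_of_sq_eq_zero hss hcomm n fun v ↦ by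
      rw [pow_two] at hf
      exact LinearMap.congr_fun (congrArg Subtype.val hf) v
    ext v
    exact LieModuleHom.congr_fun hn v
  obtain ⟨n, hn, s, -, hnil, hs, hns⟩ :=
    Module.End.exists_isNilpotent_isSemisimple (f := (φ : Module.End K M))
  have hφ : (φ : Module.End K M) ∈ E := by
    rw [Subalgebra.mem_centralizer_iff]
    rintro _ ⟨x, rfl⟩
    ext v
    exact (φ.map_lie x v).symm
  have hnE : n ∈ E := Algebra.adjoin_le (Set.singleton_subset_iff.mpr hφ) hn
  have hn0 : n = 0 := by
    obtain ⟨k, hk⟩ := hnil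
    have : IsNilpotent (⟨n, hnE⟩ : E) := ⟨k, Subtype.ext hk⟩
    exact congrArg Subtype.val this.eq_zero
  rw [hns, hn0, zero_add]
  exact hs

/- STATEMENT 5: if z ↦ (v ↦ z • v) is a bijection from Z(g₀) onto End_{g₀}(g₁), then every
even derivation of the quasireductive Lie superalgebra g is inner. -/

variable {F : Type} [Field F] [IsAlgClosed F] [CharZero F]
variable {g0 : Type} [LieRing g0] [LieAlgebra F g0] [FiniteDimensional F g0]
variable {g1 : Type} [AddCommGroup g1] [Module F g1] [FiniteDimensional F g1]
variable [LieRingModule g0 g1] [LieModule F g0 g1]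

theorem stmt5
    (br : g1 →ₗ[F] g1 →ₗ[F] g0)
    (hsymm : ∀ v w : g1, br v w = br w v)
    (hequiv : ∀ (a : g0) (v w : g1), ⁅a, br v w⁆ = br ⁅a, v⁆ w + br v ⁅a, w⁆)
    (hjac : ∀ u v w : g1, ⁅br u v, w⁆ + ⁅br v w, u⁆ + ⁅br w u, v⁆ = 0)
    (hred : LieAlgebra.radical F g0 = LieAlgebra.center F g0)
    (hss : ∀ N : LieSubmodule F g0 g1, ∃ N', IsCompl N N')
    -- z ↦ (z • ·) is a bijection of Z(g₀) onto End_{g₀}(g₁):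
    (hbij : ∀ φ : g1 →ₗ[F] g1, (∀ (a : g0) (v : g1), φ ⁅a, v⁆ = ⁅a, φ v⁆) →
      ∃! z : g0, (∀ a : g0, ⁅z, a⁆ = 0) ∧ ∀ v : g1, ⁅z, v⁆ = φ v)
    (D0 : g0 →ₗ[F] g0) (D1 : g1 →ₗ[F] g1)
    (hD0 : ∀ a b : g0, D0 ⁅a, b⁆ = ⁅D0 a, b⁆ + ⁅a, D0 b⁆)
    (hD1 : ∀ (a : g0) (v : g1), D1 ⁅a, v⁆ = ⁅D0 a, v⁆ + ⁅a, D1 v⁆)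
    (hDbr : ∀ v w : g1, D0 (br v w) = br (D1 v) w + br v (D1 w)) :
    ∃ x : g0, (∀ a : g0, D0 a = ⁅x, a⁆) ∧ (∀ v : g1, D1 v = ⁅x, v⁆) := by
  let D : LieDerivation F g0 g0 :=
    { D0 with
      leibniz' := fun a b ↦ by
        change D0 ⁅a, b⁆ = ⁅a, D0 b⁆ - ⁅b, D0 a⁆
        rw [hD0, ← lie_skew (D0 a) b]; abel }
  obtain ⟨y, hy⟩ := exists_derivation_sub_lie_mem_center hred D
  replace hy (a b : g0) : ⁅b, D0 a - ⁅y, a⁆⁆ = 0 := hy a b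
  have hy' (a b : g0) : ⁅D0 a - ⁅y, a⁆, b⁆ = 0 := by
    rw [← lie_skew, hy, neg_zero]
  let T : Module.End F g1 := D1 - LieModule.toEnd F g0 g1 y
  have hTapp (v : g1) : T v = D1 v - ⁅y, v⁆ := rfl
  have hT (a : g0) (v : g1) : T ⁅a, v⁆ = ⁅D0 a - ⁅y, a⁆, v⁆ + ⁅a, T v⁆ := by
    simp only [hTapp, hD1, sub_lie, lie_sub, lie_lie]; abel
  have hcomm (φ ψ : g1 →ₗ⁅F,g0⁆ g1) (v : g1) : φ (ψ v) = ψ (φ v) := by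
    obtain ⟨z, ⟨-, hz⟩, -⟩ := hbij φ φ.map_lie
    have hφ (w : g1) : φ w = ⁅z, w⁆ := (hz w).symm
    rw [hφ, hφ, ψ.map_lie]
  have hcenter (z : g0) (hz : z ∈ center F g0) : D0 z - ⁅y, z⁆ = 0 := by
    have hz' (a : g0) : ⁅z, a⁆ = 0 := by rw [← lie_skew, hz a, neg_zero]
    let φ : g1 →ₗ⁅F,g0⁆ g1 :=
      { LieModule.toEnd F g0 g1 z with
        map_lie' := fun {a v} ↦ by
          change ⁅z, ⁅a, v⁆⁆ = ⁅a, ⁅z, v⁆⁆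
          rw [leibniz_lie, hz', zero_lie, zero_add] }
    have hbr : T * (φ : Module.End F g1) - (φ : Module.End F g1) * T =
        LieModule.toEnd F g0 g1 (D0 z - ⁅y, z⁆) := by
      ext v
      exact sub_eq_iff_eq_add.mpr (hT z v)
    have hTφ := Module.End.commute_of_isSemisimple_of_commute_lie (T := T)
      (LieModuleHom.isSemisimple_of_commute hss hcomm φ) (by
        rw [hbr]
        ext v
        change ⁅z, ⁅D0 z - ⁅y, z⁆, v⁆⁆ = ⁅D0 z - ⁅y, z⁆, ⁅z, v⁆⁆
        rw [leibniz_lie, hz', zero_lie, zero_add])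
    rw [hTφ, sub_self] at hbr
    exact (hbij 0 (by simp)).unique
      ⟨hy' z, fun v ↦ (LinearMap.congr_fun hbr v).symm⟩ ⟨by simp, by simp⟩
  have hzero : D0 - ad F g0 y = 0 := by
    refine linearMap_eq_zero_of_vanish_on_center_and_lie hred _ hcenter fun a b ↦ ?_
    have h1 : D0 ⁅a, b⁆ - ⁅y, ⁅a, b⁆⁆ = ⁅D0 a - ⁅y, a⁆, b⁆ + ⁅a, D0 b - ⁅y, b⁆⁆ := by
      simp only [hD0, sub_lie, lie_sub, lie_lie]; abel
    exact h1.trans (by rw [hy', hy, add_zero])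
  have hD0y (a : g0) : D0 a = ⁅y, a⁆ := sub_eq_zero.mp (LinearMap.congr_fun hzero a)
  obtain ⟨z, ⟨hz, hzT⟩, -⟩ := hbij T fun a v ↦ by rw [hT, hD0y, sub_self, zero_lie, zero_add]
  refine ⟨y + z, fun a ↦ ?_, fun v ↦ ?_⟩
  · rw [add_lie, hz, add_zero, hD0y]
  · rw [add_lie, hzT, hTapp, add_sub_cancel]
end

section
/- Let g be a quasireductive finite-dimensional Lie superalgebra over F and suppose that the only g₀-module homomorphism from g₁ to g₀ (with g₀ carrying the adjoint action) is zero. Then every odd derivation of g is inner: for every odd derivation (E, F) there exists u ∈ g₁ with E(a) = −a • u for all a ∈ g₀ and F(v) = ⟨u, v⟩ for all v ∈ g₁. -/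
open LieAlgebra LieModule

lemma LinearMap.BilinForm.dualBasis_apply_eq_repr {K V ι : Type*} [Field K] [AddCommGroup V]
    [Module K V] [FiniteDimensional K V] [Finite ι] [DecidableEq ι]
    {B : LinearMap.BilinForm K V} (hB : B.Nondegenerate) (b : Module.Basis ι K V) (i : ι) (x : V) :
    B (B.dualBasis hB b i) x = b.repr x i := by
  have := Fintype.ofFinite ι
  conv_lhs => rw [← b.sum_repr x, map_sum]
  simp only [map_smul, smul_eq_mul]
  simp [LinearMap.BilinForm.apply_dualBasis_left]

lemma Commute.aeval_right {R A : Type*} [CommSemiring R] [Semiring A] [Algebra R A] {a x : A}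
    (h : Commute a x) (p : Polynomial R) : Commute a (Polynomial.aeval x p) := by
  induction p using Polynomial.induction_on' with
  | add p q hp hq => rw [map_add]; exact hp.add_right hq
  | monomial n r =>
    rw [Polynomial.aeval_monomial]
    exact (Algebra.commute_algebraMap_right r a).mul_right (h.pow_right n)

section Killing

variable {K S : Type*} [Field K] [LieRing S] [LieAlgebra K S]

/-- The Casimir tensor attached to the Killing form is invariant: contracting it with any bilinear
map gives zero after acting with `a` on both factors. -/
lemma LieAlgebra.IsKilling.sum_lie_dualBasis_eq_zero [FiniteDimensional K S] [IsKilling K S]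
    {ι N : Type*} [Fintype ι] [DecidableEq ι] [AddCommGroup N] [Module K N]
    (b : Module.Basis ι K S) (f : S →ₗ[K] S →ₗ[K] N) (a : S) :
    ∑ i, f ⁅a, b i⁆ ((killingForm K S).dualBasis (IsKilling.killingForm_nondegenerate K S) b i) +
      ∑ i, f (b i) ⁅a, (killingForm K S).dualBasis
        (IsKilling.killingForm_nondegenerate K S) b i⁆ = 0 := by
  set b' := (killingForm K S).dualBasis (IsKilling.killingForm_nondegenerate K S) b with hb'
  have h1 (x : S) : x = ∑ j, killingForm K S (b' j) x • b j := by
    simp [hb', LinearMap.BilinForm.dualBasis_apply_eq_repr, b.sum_repr]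
  have h2 (x : S) : x = ∑ j, killingForm K S x (b j) • b' j := by
    conv_lhs => rw [← b'.sum_repr x]
    simp [hb', LinearMap.BilinForm.dualBasis_repr_apply]
  have h3 : ∑ i, f ⁅a, b i⁆ (b' i) =
      ∑ i, ∑ j, killingForm K S (b' j) ⁅a, b i⁆ • f (b j) (b' i) := by
    refine Finset.sum_congr rfl fun i _ ↦ ?_
    conv_lhs => rw [h1 ⁅a, b i⁆]
    simp
  have h4 : ∑ i, f (b i) ⁅a, b' i⁆ =
      ∑ i, ∑ j, killingForm K S ⁅a, b' i⁆ (b j) • f (b i) (b' j) := by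
    refine Finset.sum_congr rfl fun i _ ↦ ?_
    conv_lhs => rw [h2 ⁅a, b' i⁆]
    simp
  rw [h3, h4, Finset.sum_comm, ← Finset.sum_add_distrib]
  refine Finset.sum_eq_zero fun i _ ↦ ?_
  rw [← Finset.sum_add_distrib]
  refine Finset.sum_eq_zero fun j _ ↦ ?_
  have h5 : killingForm K S (b' i) ⁅a, b j⁆ + killingForm K S ⁅a, b' i⁆ (b j) = 0 := by
    rw [← LieModule.traceForm_apply_lie_apply K S S (b' i) a (b j), ← lie_skew (b' i) a,
      map_neg, LinearMap.neg_apply, neg_add_cancel]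
  rw [← add_smul, h5, zero_smul]

/-- A Lie algebra with non-degenerate Killing form is perfect. -/
lemma LieAlgebra.IsKilling.derivedSeries_one_eq_top [FiniteDimensional K S] [IsKilling K S] :
    derivedSeries K S 1 = ⊤ := by
  have h : (derivedSeries K S 1).killingCompl ≤ ⊥ := by
    rw [← LieAlgebra.center_eq_bot K S]
    intro x hx
    rw [LieModule.mem_maxTrivSubmodule]
    intro y
    have := (IsKilling.killingForm_nondegenerate K S).1 ⁅y, x⁆
    refine this fun z ↦ ?_
    rw [LieModule.traceForm_comm, ← LieModule.traceForm_apply_lie_apply]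
    rw [LieIdeal.mem_killingCompl] at hx
    exact hx _ (LieSubmodule.lie_mem_lie (LieSubmodule.mem_top z) (LieSubmodule.mem_top y))
  have := (LieIdeal.isCompl_killingCompl (derivedSeries K S 1)).sup_eq_top
  rwa [le_bot_iff.mp h, sup_bot_eq] at this

/-- An element of the centroid of a Lie algebra without abelian ideals has
`ker (φ ^ 2) = ker φ`. -/
lemma LieModuleHom.apply_eq_zero_of_apply_apply_eq_zero [HasTrivialRadical K S]
    (φ : S →ₗ⁅K, S⁆ S) {x : S} (hx : φ (φ x) = 0) : φ x = 0 := by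
  let I : LieIdeal K S := φ.ker ⊓ φ.range
  have hI : IsLieAbelian I := by
    refine ⟨?_⟩
    rintro ⟨u, hu⟩ ⟨v, hv⟩
    obtain ⟨hu, -⟩ := (LieSubmodule.mem_inf _ _ _).mp hu
    obtain ⟨-, hv⟩ := (LieSubmodule.mem_inf _ _ _).mp hv
    obtain ⟨y, rfl⟩ := hv
    rw [Subtype.ext_iff]
    change ⁅u, φ y⁆ = 0
    rw [← LieModuleHom.map_lie, ← lie_skew, map_neg, LieModuleHom.map_lie, φ.mem_ker.mp hu]
    simp
  have h := (hasTrivialRadical_iff_no_abelian_ideals K S).mp inferInstance I hI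
  have : φ x ∈ I := (LieSubmodule.mem_inf _ _ _).mpr ⟨φ.mem_ker.mpr hx, x, rfl⟩
  rwa [h, LieSubmodule.mem_bot] at this

end Killing

open Polynomial in
/-- A linear endomorphism with `ker (φ ^ 2) = ker φ` is strongly regular: it factors through its
square by a polynomial in itself. -/
lemma Module.End.exists_aeval_mul_eq_self {K V : Type*} [Field K] [AddCommGroup V] [Module K V]
    [FiniteDimensional K V] (φ : Module.End K V) (h : ∀ x, φ (φ x) = 0 → φ x = 0) :
    ∃ p : K[X], φ * φ * aeval φ p = φ := by
  classical
  have hnd : ¬ X ^ 2 ∣ minpoly K φ := by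
    rintro ⟨r, hr⟩
    have h0 : aeval φ (X * r) = 0 := by
      ext x
      have := congr($(minpoly.aeval K φ) x)
      rw [hr] at this
      simp only [map_mul, aeval_X, pow_two, Module.End.mul_apply,
        LinearMap.zero_apply] at this ⊢
      exact h _ this
    have hne : minpoly K φ ≠ 0 :=
      minpoly.ne_zero (Algebra.IsIntegral.isIntegral (R := K) φ)
    have hdvd := minpoly.dvd K φ h0
    rw [hr] at hne hdvd
    have hXr : X * r ≠ 0 := mul_ne_zero X_ne_zero (right_ne_zero_of_mul hne)
    rw [pow_two, mul_assoc] at hdvd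
    have hX1 : (X : K[X]) ∣ 1 := (mul_dvd_mul_iff_right hXr).mp (by rwa [one_mul])
    exact not_isUnit_X (isUnit_of_dvd_one hX1)
  have hg : EuclideanDomain.gcd (X ^ 2) (minpoly K φ) ∣ X := by
    obtain ⟨i, hi, h1⟩ := (dvd_prime_pow prime_X 2).mp
      (EuclideanDomain.gcd_dvd_left (X ^ 2) (minpoly K φ))
    have hi2 : i ≠ 2 := by
      rintro rfl
      exact hnd (h1.dvd'.trans (EuclideanDomain.gcd_dvd_right _ _))
    exact h1.dvd.trans ((pow_dvd_pow X (by omega : i ≤ 1)).trans (pow_one X).dvd)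
  obtain ⟨c, hc⟩ := hg
  rw [EuclideanDomain.gcd_eq_gcd_ab] at hc
  refine ⟨EuclideanDomain.gcdA (X ^ 2) (minpoly K φ) * c, ?_⟩
  have := congr(aeval φ $hc)
  simp only [map_mul, map_add, map_pow, aeval_X, minpoly.aeval, zero_mul, add_zero] at this
  rw [map_mul, ← pow_two, ← mul_assoc]
  exact this.symm

section Casimir

variable {K S M : Type*} [Field K] [CharZero K] [LieRing S] [LieAlgebra K S]
  [FiniteDimensional K S] [AddCommGroup M] [Module K M] [FiniteDimensional K M]
  [LieRingModule S M] [LieModule K S M]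

/-- On a non-trivial irreducible module over a semisimple Lie algebra, the trace form does not
vanish. -/
lemma LieModule.traceForm_ne_zero_of_isIrreducible [IsKilling K S]
    [LieModule.IsIrreducible K S M] (h : ¬ LieModule.IsTrivial S M) :
    traceForm K S M ≠ 0 := by
  intro h0
  have hnil := isNilpotent_derivedSeries_of_traceForm_eq_zero h0
  have := LieModule.nontrivial_of_isIrreducible K S M
  obtain ⟨⟨m, hm⟩, hm0⟩ := @exists_ne _
    (nontrivial_max_triv_of_isNilpotent K (derivedSeries K S 1) M) 0
  have hmS : m ∈ maxTrivSubmodule K S M := by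
    intro x
    have hx : x ∈ derivedSeries K S 1 := by
      rw [IsKilling.derivedSeries_one_eq_top]; exact LieSubmodule.mem_top x
    exact hm ⟨x, hx⟩
  rw [isTrivial_iff_max_triv_eq_top K S M] at h
  rcases eq_bot_or_eq_top (maxTrivSubmodule K S M) with hb | ht
  · rw [hb, LieSubmodule.mem_bot] at hmS
    exact hm0 (Subtype.ext hmS)
  · exact h ht

omit [CharZero K] [FiniteDimensional K M] in
/-- The endomorphism relating the trace form of a module to the Killing form. -/
lemma LieModule.exists_killingForm_apply_eq_traceForm [IsKilling K S] :
    ∃ φ : S →ₗ⁅K, S⁆ S, ∀ x y, killingForm K S (φ x) y = traceForm K S M x y := by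
  have hnd := IsKilling.killingForm_nondegenerate K S
  let φ : S →ₗ[K] S := ((killingForm K S).toDual hnd).symm.toLinearMap ∘ₗ traceForm K S M
  have hφ (x y : S) : killingForm K S (φ x) y = traceForm K S M x y :=
    LinearMap.BilinForm.apply_toDual_symm_apply (hB := hnd) (traceForm K S M x) y
  refine ⟨{ φ with map_lie' := fun {a x} ↦ ?_ }, hφ⟩
  change φ ⁅a, x⁆ = ⁅a, φ x⁆
  rw [← sub_eq_zero]
  refine hnd.1 _ fun y ↦ ?_
  rw [map_sub, LinearMap.sub_apply, hφ, ← lie_skew, ← lie_skew a (φ x), map_neg, map_neg,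
    LinearMap.neg_apply, LinearMap.neg_apply, LieModule.traceForm_apply_lie_apply,
    LieModule.traceForm_apply_lie_apply, ← hφ, sub_self]

/-- Whitehead's first lemma for non-trivial irreducible modules. -/
lemma LieModule.exists_eq_neg_lie_of_isIrreducible_of_isKilling [IsKilling K S]
    [LieModule.IsIrreducible K S M] (h : ¬ LieModule.IsTrivial S M)
    (E : S →ₗ[K] M) (hE : ∀ a b : S, E ⁅a, b⁆ = ⁅a, E b⁆ - ⁅b, E a⁆) :
    ∃ u : M, ∀ a, E a = -⁅a, u⁆ := by
  obtain ⟨φ, hφ⟩ := LieModule.exists_killingForm_apply_eq_traceForm (K := K) (S := S) (M := M)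
  have hφ0 : (φ : Module.End K S) ≠ 0 := by
    intro h0
    refine LieModule.traceForm_ne_zero_of_isIrreducible h (K := K) ?_
    ext x y
    have hx : φ x = 0 := congr($h0 x)
    rw [← hφ, hx]
    simp
  obtain ⟨p, hp⟩ := Module.End.exists_aeval_mul_eq_self (φ : Module.End K S)
    fun x hx ↦ φ.apply_eq_zero_of_apply_apply_eq_zero hx
  set ψ : Module.End K S := Polynomial.aeval (φ : Module.End K S) p with hψ
  have hψφ : Commute (φ : Module.End K S) ψ := (Commute.refl _).aeval_right p
  have hidem : IsIdempotentElem ((φ : Module.End K S) * ψ) := by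
    rw [IsIdempotentElem, mul_assoc, ← mul_assoc ψ, ← hψφ.eq, ← mul_assoc, ← mul_assoc, hp]
  have htr : LinearMap.trace K S ((φ : Module.End K S) * ψ) ≠ 0 := by
    intro h0
    apply hφ0
    rw [← hp, mul_assoc, LinearMap.IsIdempotentElem.eq_zero_of_trace_eq_zero hidem h0, mul_zero]
  have hψlie (a x : S) : ψ ⁅a, x⁆ = ⁅a, ψ x⁆ := by
    have hc : Commute (ad K S a) (φ : Module.End K S) := by
      ext y
      exact (φ.map_lie a y).symm
    exact congr($((hc.aeval_right p).eq) x).symm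
  let b := Module.finBasis K S
  let b' := (killingForm K S).dualBasis (IsKilling.killingForm_nondegenerate K S) b
  let C : M →ₗ[K] M := ∑ i, toEnd K S M (ψ (b i)) ∘ₗ toEnd K S M (b' i)
  have hC (m : M) : C m = ∑ i, ⁅ψ (b i), ⁅b' i, m⁆⁆ := by simp [C]
  have hClie (a : S) (m : M) : C ⁅a, m⁆ = ⁅a, C m⁆ := by
    have := IsKilling.sum_lie_dualBasis_eq_zero b
      (LinearMap.mk₂ K (fun x y ↦ ⁅ψ x, ⁅y, m⁆⁆) (by simp) (by simp) (by simp) (by simp)) a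
    simp only [LinearMap.mk₂_apply, hψlie, ← Finset.sum_add_distrib] at this
    rw [hC, hC, lie_sum, eq_comm, ← sub_eq_zero, ← Finset.sum_sub_distrib, ← this]
    refine Finset.sum_congr rfl fun i _ ↦ ?_
    simp only [lie_lie, lie_sub, b']
    abel
  have hCtr : LinearMap.trace K M C = LinearMap.trace K S ((φ : Module.End K S) * ψ) := by
    rw [LinearMap.trace_eq_matrix_trace K b ((φ : Module.End K S) * ψ), Matrix.trace, map_sum]
    refine Finset.sum_congr rfl fun i _ ↦ ?_
    rw [← LieModule.traceForm_apply_apply, ← hφ, LieModule.traceForm_comm,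
      LinearMap.BilinForm.dualBasis_apply_eq_repr, Matrix.diag_apply, LinearMap.toMatrix_apply]
    rfl
  let N : LieSubmodule K S M :=
    { LinearMap.ker C with
      lie_mem := fun {a m} (hm : C m = 0) ↦ by
        change C ⁅a, m⁆ = 0
        rw [hClie, hm, lie_zero] }
  have hN (m : M) : m ∈ N ↔ C m = 0 := Iff.rfl
  have hCinj : Function.Injective C := by
    rw [injective_iff_map_eq_zero]
    intro m hm
    rcases eq_bot_or_eq_top N with hb | ht
    · rwa [← hN, hb, LieSubmodule.mem_bot] at hm
    · have hC0 : C = 0 := by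
        ext m
        exact (hN m).mp (ht ▸ LieSubmodule.mem_top m)
      rw [← hCtr, hC0, map_zero] at htr
      exact absurd rfl htr
  obtain ⟨D, hD⟩ := (LinearMap.injective_iff_surjective.mp hCinj).hasRightInverse
  let m₀ := ∑ i, ⁅ψ (b i), E (b' i)⁆
  have hm₀ (a : S) : ⁅a, m₀⁆ = C (E a) := by
    have := IsKilling.sum_lie_dualBasis_eq_zero b
      (LinearMap.mk₂ K (fun x y ↦ ⁅ψ x, E y⁆) (by simp) (by simp) (by simp) (by simp)) a
    simp only [LinearMap.mk₂_apply, hψlie, hE, ← Finset.sum_add_distrib] at this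
    rw [hC, lie_sum, ← sub_eq_zero, ← Finset.sum_sub_distrib, ← this]
    refine Finset.sum_congr rfl fun i _ ↦ ?_
    simp only [lie_lie, lie_sub, b']
    abel
  refine ⟨-D m₀, fun a ↦ hCinj ?_⟩
  rw [lie_neg, neg_neg, hClie, hD, hm₀]

end Casimir

section Reductive

/-- The quotient of a reductive Lie algebra by its center is semisimple. -/
lemma LieAlgebra.hasTrivialRadical_quotient_center_s6 {R L : Type*} [CommRing R] [LieRing L]
    [LieAlgebra R L] [IsNoetherian R L] [HasCentralRadical R L] :
    HasTrivialRadical R (L ⧸ center R L) := by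
  rw [hasTrivialRadical_iff_no_abelian_ideals]
  intro I hI
  have hmem {x y : L} (hx : LieSubmodule.Quotient.mk (N := center R L) x ∈ I)
      (hy : LieSubmodule.Quotient.mk (N := center R L) y ∈ I) : ⁅x, y⁆ ∈ center R L := by
    rw [← LieSubmodule.Quotient.mk_eq_zero', LieSubmodule.Quotient.mk_bracket]
    exact congr($(hI.trivial ⟨_, hx⟩ ⟨_, hy⟩).1)
  let J : LieIdeal R L :=
    { I.toSubmodule.comap (LieSubmodule.Quotient.mk' (center R L) : L →ₗ[R] L ⧸ center R L) with
      lie_mem := fun {x y} hy ↦ I.lie_mem (x := LieSubmodule.Quotient.mk x) hy }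
  have hJJ : ⁅J, J⁆ ≤ center R L :=
    (LieSubmodule.lie_le_iff _ _ _).mpr fun x hx y hy ↦ hmem hx hy
  have hJ : IsSolvable J := by
    rw [LieAlgebra.isSolvable_iff R]
    refine ⟨2, ?_⟩
    rw [LieIdeal.derivedSeries_eq_bot_iff]
    change ⁅⁅J, J⁆, ⁅J, J⁆⁆ = ⊥
    rw [← LieSubmodule.lie_abelian_iff_lie_self_eq_bot]
    exact abelian_of_le_center _ _ _ hJJ
  rw [LieIdeal.solvable_iff_le_radical, radical_eq_center] at hJ
  rw [eq_bot_iff]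
  intro x hx
  obtain ⟨x, rfl⟩ := LieSubmodule.Quotient.surjective_mk' _ x
  rw [LieSubmodule.mem_bot, LieSubmodule.Quotient.mk_eq_zero]
  exact hJ hx

variable {K L M : Type*} [Field K] [CharZero K] [LieRing L] [LieAlgebra K L]
  [FiniteDimensional K L] [AddCommGroup M] [Module K M] [FiniteDimensional K M]
  [LieRingModule L M] [LieModule K L M]

/-- Cocycles of a reductive Lie algebra with values in a non-trivial irreducible module are
coboundaries. -/
lemma LieModule.exists_eq_neg_lie_of_isIrreducible [HasCentralRadical K L]
    [LieModule.IsIrreducible K L M] (h : ¬ LieModule.IsTrivial L M)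
    (E : L →ₗ[K] M) (hE : ∀ a b : L, E ⁅a, b⁆ = ⁅a, E b⁆ - ⁅b, E a⁆) :
    ∃ u : M, ∀ a, E a = -⁅a, u⁆ := by
  have hcz {z : L} (hz : z ∈ center K L) (a : L) : ⁅a, z⁆ = 0 := hz a
  by_cases hZ : ∀ z ∈ center K L, ∀ m : M, ⁅z, m⁆ = 0
  · have hEZ : ∀ z ∈ center K L, E z = 0 := by
      intro z hz
      have hm : E z ∈ maxTrivSubmodule K L M := by
        intro a
        have := hE a z
        rwa [hcz hz, map_zero, hZ z hz, sub_zero, eq_comm] at this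
      rcases eq_bot_or_eq_top (maxTrivSubmodule K L M) with hb | ht
      · rwa [hb, LieSubmodule.mem_bot] at hm
      · exact absurd ((isTrivial_iff_max_triv_eq_top K L M).mpr ht) h
    have := hasTrivialRadical_quotient_center_s6 (R := K) (L := L)
    let π : L →ₗ[K] L ⧸ center K L := LieSubmodule.Quotient.mk' (center K L)
    obtain ⟨s, hs⟩ := π.exists_rightInverse_of_surjective
      (LinearMap.range_eq_top.mpr (LieSubmodule.Quotient.surjective_mk' _))
    have hsub {x y : L} (hxy : π x = π y) : x - y ∈ center K L := by
      rw [← LieSubmodule.Quotient.mk_eq_zero]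
      change π (x - y) = 0
      rw [map_sub, hxy, sub_self]
    have hπs (x : L ⧸ center K L) : π (s x) = x := congr($hs x)
    have hπlie (x y : L) : π ⁅x, y⁆ = ⁅π x, π y⁆ :=
      LieSubmodule.Quotient.mk_bracket (I := center K L) x y
    have hact {x y : L} (hxy : π x = π y) (m : M) : ⁅x, m⁆ = ⁅y, m⁆ := by
      rw [← sub_eq_zero, ← sub_lie]
      exact hZ _ (hsub hxy) m
    have hEπ {x y : L} (hxy : π x = π y) : E x = E y := by
      rw [← sub_eq_zero, ← map_sub]
      exact hEZ _ (hsub hxy)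
    let _ : LieRingModule (L ⧸ center K L) M :=
      { bracket := fun x m ↦ ⁅s x, m⁆
        add_lie := fun x y m ↦ by
          change ⁅s (x + y), m⁆ = ⁅s x, m⁆ + ⁅s y, m⁆
          rw [map_add, add_lie]
        lie_add := fun x m n ↦ lie_add (s x) m n
        leibniz_lie := fun x y m ↦ by
          change ⁅s x, ⁅s y, m⁆⁆ = ⁅s ⁅x, y⁆, m⁆ + ⁅s y, ⁅s x, m⁆⁆
          rw [leibniz_lie, hact (x := ⁅s x, s y⁆) (y := s ⁅x, y⁆)]
          rw [hπlie, hπs, hπs, hπs] }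
    have hlie (x : L ⧸ center K L) (m : M) : ⁅x, m⁆ = ⁅s x, m⁆ := rfl
    have hlie' (x : L) (m : M) : ⁅π x, m⁆ = ⁅x, m⁆ := hact (hπs _) m
    let _ : LieModule K (L ⧸ center K L) M :=
      { smul_lie := fun t x m ↦ by rw [hlie, hlie, map_smul, smul_lie]
        lie_smul := fun t x m ↦ by rw [hlie, hlie, lie_smul] }
    have := LieModule.nontrivial_of_isIrreducible K L M
    have hirr : LieModule.IsIrreducible K (L ⧸ center K L) M := by
      refine LieModule.IsIrreducible.mk fun N hN ↦ ?_
      let N' : LieSubmodule K L M :=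
        { N.toSubmodule with
          lie_mem := fun {a m} hm ↦ by
            have := N.lie_mem (x := π a) hm
            rwa [hlie'] at this }
      have hN' : N' = ⊤ := (eq_bot_or_eq_top N').resolve_left fun hb ↦ hN <| by
        rw [← LieSubmodule.toSubmodule_eq_bot] at hb ⊢
        exact hb
      rw [← LieSubmodule.toSubmodule_eq_top] at hN' ⊢
      exact hN'
    have htriv : ¬ LieModule.IsTrivial (L ⧸ center K L) M := fun ht ↦
      h ⟨fun x m ↦ by rw [← hlie', ht.trivial]⟩
    obtain ⟨u, hu⟩ := LieModule.exists_eq_neg_lie_of_isIrreducible_of_isKilling htriv (E ∘ₗ s)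
      fun a b ↦ by
        rw [hlie, hlie, LinearMap.comp_apply, LinearMap.comp_apply, LinearMap.comp_apply, ← hE]
        exact hEπ (by rw [hπlie, hπs, hπs, hπs])
    refine ⟨u, fun a ↦ ?_⟩
    rw [← hlie', ← hu]
    exact hEπ (hπs _).symm
  · push Not at hZ
    obtain ⟨z, hz, m₁, hm₁⟩ := hZ
    have hcomm (a : L) (m : M) : ⁅a, ⁅z, m⁆⁆ = ⁅z, ⁅a, m⁆⁆ := by
      rw [leibniz_lie, hcz hz, zero_lie, zero_add]
    let N : LieSubmodule K L M :=
      { LinearMap.ker (toEnd K L M z) with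
        lie_mem := fun {a m} (hm : ⁅z, m⁆ = 0) ↦ by
          change ⁅z, ⁅a, m⁆⁆ = 0
          rw [← hcomm, hm, lie_zero] }
    have hN (m : M) : m ∈ N ↔ ⁅z, m⁆ = 0 := Iff.rfl
    have hinj : Function.Injective (toEnd K L M z) := by
      rw [injective_iff_map_eq_zero]
      intro m hm
      rcases eq_bot_or_eq_top N with hb | ht
      · rwa [toEnd_apply_apply, ← hN, hb, LieSubmodule.mem_bot] at hm
      · exact absurd ((hN m₁).mp (ht ▸ LieSubmodule.mem_top m₁)) hm₁
    obtain ⟨u, hu⟩ := LinearMap.injective_iff_surjective.mp hinj (E z)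
    rw [toEnd_apply_apply] at hu
    refine ⟨-u, fun a ↦ hinj ?_⟩
    have := hE a z
    rw [hcz hz, map_zero, eq_comm, sub_eq_zero] at this
    rw [lie_neg, neg_neg, toEnd_apply_apply, toEnd_apply_apply, ← this, ← hu, hcomm]

end Reductive

section Semisimple

variable {K L M : Type*} [Field K] [LieRing L] [AddCommGroup M] [Module K M] [LieRingModule L M]

/-- The equivariant projection onto a complemented Lie submodule. -/
lemma LieSubmodule.exists_projection_of_isCompl {A A' : LieSubmodule K L M} (h : IsCompl A A') :
    ∃ p : M →ₗ⁅K, L⁆ A, ∀ x : A, p x = x := by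
  have h' := LieSubmodule.isCompl_toSubmodule.mpr h
  let p : M →ₗ[K] A := Submodule.projectionOnto A.toSubmodule A'.toSubmodule h'
  have hp (x : A) : p x = x := Submodule.projectionOnto_apply_left h' x
  have hp' {x : M} (hx : x ∈ A') : p x = 0 := Submodule.projectionOnto_apply_right h' ⟨x, hx⟩
  refine ⟨{ p with map_lie' := fun {a m} ↦ ?_ }, hp⟩
  change p ⁅a, m⁆ = ⁅a, p m⁆
  have hm : m ∈ A ⊔ A' := h.sup_eq_top ▸ LieSubmodule.mem_top m
  obtain ⟨x, hx, y, hy, rfl⟩ := (LieSubmodule.mem_sup _ _ _).mp hm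
  have hpx : ⁅a, p x⁆ = p ⁅a, x⁆ := by
    rw [hp ⟨x, hx⟩]
    exact (hp ⟨_, A.lie_mem hx⟩).symm
  rw [lie_add, map_add, map_add, lie_add, hpx, hp' hy, hp' (A'.lie_mem hy), lie_zero]

lemma LieSubmodule.isIrreducible_of_isAtom {A : LieSubmodule K L M} (hA : IsAtom A) :
    LieModule.IsIrreducible K L A := by
  have : Nontrivial A := (LieSubmodule.nontrivial_iff_ne_bot K L M).mpr hA.1
  refine LieModule.IsIrreducible.mk fun N hN ↦ ?_
  have hle : N.map A.incl ≤ A := by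
    intro x hx
    obtain ⟨y, -, rfl⟩ := (LieSubmodule.mem_map x).mp hx
    exact y.2
  rcases hA.le_iff.mp hle with h | h
  · refine absurd ((LieSubmodule.eq_bot_iff N).mpr fun y hy ↦ ?_) hN
    have : A.incl y ∈ N.map A.incl := LieSubmodule.mem_map_of_mem hy
    rw [h, LieSubmodule.mem_bot] at this
    exact Subtype.ext this
  · refine eq_top_iff.mpr fun y _ ↦ ?_
    have hy : (y : M) ∈ N.map A.incl := h.symm ▸ y.2
    obtain ⟨z, hz, hzy⟩ := (LieSubmodule.mem_map _).mp hy
    rwa [← Subtype.ext hzy]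

/-- Cocycles with values in a semisimple module are coboundaries as soon as this holds for the
cocycles with values in each irreducible submodule. -/
lemma LieModule.exists_eq_neg_lie_of_forall_isAtom [LieAlgebra K L] [LieModule K L M]
    [FiniteDimensional K M]
    (hss : ∀ N : LieSubmodule K L M, ∃ N', IsCompl N N')
    (hatom : ∀ A : LieSubmodule K L M, IsAtom A → ∀ E : L →ₗ[K] A,
      (∀ a b : L, E ⁅a, b⁆ = ⁅a, E b⁆ - ⁅b, E a⁆) → ∃ u : A, ∀ a, E a = -⁅a, u⁆)
    (E : L →ₗ[K] M) (hE : ∀ a b : L, E ⁅a, b⁆ = ⁅a, E b⁆ - ⁅b, E a⁆) :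
    ∃ u : M, ∀ a, E a = -⁅a, u⁆ := by
  have := LieSubmodule.wellFoundedLT_of_isArtinian K L M
  obtain ⟨N, ⟨u, hu⟩, hmin⟩ := WellFounded.has_min (wellFounded_lt (α := LieSubmodule K L M))
    {N | ∃ u : M, ∀ a, E a + ⁅a, u⁆ ∈ N} ⟨⊤, 0, fun a ↦ LieSubmodule.mem_top _⟩
  rcases eq_bot_or_exists_atom_le N with rfl | ⟨A, hA, hAN⟩
  · exact ⟨u, fun a ↦ eq_neg_of_add_eq_zero_left ((LieSubmodule.mem_bot _).mp (hu a))⟩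
  obtain ⟨A', hAA'⟩ := hss A
  obtain ⟨p, hp⟩ := LieSubmodule.exists_projection_of_isCompl hAA'
  let E' : L →ₗ[K] A :=
    { toFun := fun a ↦ p (E a + ⁅a, u⁆)
      map_add' := fun a b ↦ by rw [map_add E, add_lie, add_add_add_comm, map_add p]
      map_smul' := fun t a ↦ by rw [map_smul, smul_lie, ← smul_add, map_smul, RingHom.id_apply] }
  have hE'a (a : L) : E' a = p (E a + ⁅a, u⁆) := rfl
  obtain ⟨v, hv⟩ := hatom A hA E' fun a b ↦ by
    rw [hE'a, hE'a, hE'a, hE, ← LieModuleHom.map_lie, ← LieModuleHom.map_lie, ← map_sub, lie_lie,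
      lie_add, lie_add]
    congr 1
    abel
  refine absurd (inf_le_left.lt_of_ne fun h ↦ ?_ : N ⊓ p.ker < N)
    (hmin (N ⊓ p.ker) ⟨u + v, fun a ↦ ?_⟩)
  · have : A ≤ ⊥ := fun x hx ↦ by
      have hx' := p.mem_ker.mp (inf_eq_left.mp h (hAN hx))
      rw [hp ⟨x, hx⟩] at hx'
      exact (LieSubmodule.mem_bot x).mpr congr(($hx' : M))
    exact hA.1 (le_bot_iff.mp this)
  · rw [lie_add, ← add_assoc]
    refine (LieSubmodule.mem_inf _ _ _).mpr ⟨add_mem (hu a) (hAN (A.lie_mem v.2)), ?_⟩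
    have hpv : p ⁅a, (v : M)⁆ = ⁅a, v⁆ := hp ⁅a, v⁆
    rw [LieModuleHom.mem_ker, map_add, hpv, ← hE'a, hv, neg_add_cancel]

end Semisimple

/- STATEMENT 6: if the only g₀-module homomorphism g₁ → g₀ (adjoint action) is zero, then
every odd derivation of the quasireductive Lie superalgebra g is inner. -/

variable {F : Type} [Field F] [IsAlgClosed F] [CharZero F]
variable {g0 : Type} [LieRing g0] [LieAlgebra F g0] [FiniteDimensional F g0]
variable {g1 : Type} [AddCommGroup g1] [Module F g1] [FiniteDimensional F g1]
variable [LieRingModule g0 g1] [LieModule F g0 g1]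

theorem stmt6
    (br : g1 →ₗ[F] g1 →ₗ[F] g0)
    (hsymm : ∀ v w : g1, br v w = br w v)
    (hequiv : ∀ (a : g0) (v w : g1), ⁅a, br v w⁆ = br ⁅a, v⁆ w + br v ⁅a, w⁆)
    (hjac : ∀ u v w : g1, ⁅br u v, w⁆ + ⁅br v w, u⁆ + ⁅br w u, v⁆ = 0)
    (hred : LieAlgebra.radical F g0 = LieAlgebra.center F g0)
    (hss : ∀ N : LieSubmodule F g0 g1, ∃ N', IsCompl N N')
    -- Hom_{g₀}(g₁, g₀) = 0:
    (hhom : ∀ φ : g1 →ₗ[F] g0, (∀ (a : g0) (v : g1), φ ⁅a, v⁆ = ⁅a, φ v⁆) → φ = 0)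
    (E : g0 →ₗ[F] g1) (Fm : g1 →ₗ[F] g0)
    (hE : ∀ a b : g0, E ⁅a, b⁆ = ⁅a, E b⁆ - ⁅b, E a⁆)
    (hF : ∀ (a : g0) (v : g1), Fm ⁅a, v⁆ = br (E a) v + ⁅a, Fm v⁆)
    (hEbr : ∀ v w : g1, E (br v w) = ⁅Fm v, w⁆ + ⁅Fm w, v⁆) :
    ∃ u : g1, (∀ a : g0, E a = -⁅a, u⁆) ∧ (∀ v : g1, Fm v = br u v) := by
  have : HasCentralRadical F g0 := ⟨hred⟩
  obtain ⟨u, hu⟩ := LieModule.exists_eq_neg_lie_of_forall_isAtom hss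
    (fun A hA E' hE' ↦ by
      have := LieSubmodule.isIrreducible_of_isAtom hA
      by_cases htriv : LieModule.IsTrivial g0 A
      · have hcenter : center F g0 = ⊥ := by
          rw [LieSubmodule.eq_bot_iff]
          intro z hz
          obtain ⟨A', hAA'⟩ := hss A
          obtain ⟨p, hp⟩ := LieSubmodule.exists_projection_of_isCompl hAA'
          have := LieModule.nontrivial_of_isIrreducible F g0 A
          obtain ⟨x, hx⟩ := exists_ne (0 : A)
          obtain ⟨f, hf⟩ := Module.Projective.exists_dual_ne_zero F hx
          have h0 := hhom ((f ∘ₗ p.toLinearMap).smulRight z) fun a v ↦ by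
            have hz' : ⁅a, z⁆ = 0 := hz a
            have hpa : p ⁅a, v⁆ = 0 := by rw [LieModuleHom.map_lie, htriv.trivial]
            simp [hz', hpa]
          have := congr($h0 x)
          simpa [hp, hf] using this
        have : HasTrivialRadical F g0 := ⟨hred.trans hcenter⟩
        refine ⟨0, fun a ↦ ?_⟩
        have ha : a ∈ ⁅(⊤ : LieIdeal F g0), (⊤ : LieIdeal F g0)⁆ := by
          have h := IsKilling.derivedSeries_one_eq_top (K := F) (S := g0)
          change ⁅(⊤ : LieIdeal F g0), (⊤ : LieIdeal F g0)⁆ = ⊤ at h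
          rw [h]
          exact LieSubmodule.mem_top a
        rw [lie_zero, neg_zero]
        rw [← LieSubmodule.mem_toSubmodule, LieSubmodule.lieIdeal_oper_eq_linear_span'] at ha
        induction ha using Submodule.span_induction with
        | mem x hx =>
          obtain ⟨y, -, z, -, rfl⟩ := hx
          rw [hE', htriv.trivial, htriv.trivial, sub_zero]
        | zero => exact map_zero _
        | add x y _ _ hx hy => rw [map_add, hx, hy, add_zero]
        | smul t x _ hx => rw [map_smul, hx, smul_zero]
      · exact LieModule.exists_eq_neg_lie_of_isIrreducible htriv E' hE') E hE
  refine ⟨u, hu, fun v ↦ ?_⟩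
  have h0 := hhom (Fm - br u) fun a v ↦ by
    rw [LinearMap.sub_apply, LinearMap.sub_apply, hF, hu, lie_sub, hequiv, map_neg,
      LinearMap.neg_apply]
    abel
  exact sub_eq_zero.mp congr($h0 v)
end
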